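/- There is a surjective group homomorphism from the braid group B_3 onto SL(2,ℤ) whose kernel is infinite cyclic, generated by the square of a generator of the center of B_3 (the element (σ_1 σ_2)^6 = ((σ_1 σ_2 σ_1)^2)^2... specifically (σ_1σ_2σ_1)^4). -/

import Mathlib

/-- The braid relation for the 3-strand braid group
`B₃ = ⟨σ₁, σ₂ | σ₁σ₂σ₁ = σ₂σ₁σ₂⟩`. -/
def braidRel : Set (FreeGroup (Fin 2)) :=
  {FreeGroup.of 0 * FreeGroup.of 1 * FreeGroup.of 0 *
    (FreeGroup.of 1 * FreeGroup.of 0 * FreeGroup.of 1)⁻¹}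

/-- The braid group on three strands. -/
abbrev BraidThree := PresentedGroup braidRel

/-- The generator `σ₁` of `B₃`. -/
def sigma1 : BraidThree := PresentedGroup.of 0

/-- The generator `σ₂` of `B₃`. -/
def sigma2 : BraidThree := PresentedGroup.of 1

open Matrix (SpecialLinearGroup)

theorem bt_rel : sigma1 * sigma2 * sigma1 = sigma2 * sigma1 * sigma2 := by
  have h : PresentedGroup.mk braidRel (FreeGroup.of 0 * FreeGroup.of 1 * FreeGroup.of 0 *
    (FreeGroup.of 1 * FreeGroup.of 0 * FreeGroup.of 1)⁻¹) = 1 :=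
    PresentedGroup.one_of_mem (by simp [braidRel])
  simp only [map_mul, map_inv] at h
  exact mul_inv_eq_one.mp h

theorem bt_induction {P : BraidThree → Prop} (h1 : P 1)
    (ha : ∀ g, P g → P (sigma1 * g)) (hb : ∀ g, P g → P (sigma2 * g))
    (ha' : ∀ g, P g → P (sigma1⁻¹ * g)) (hb' : ∀ g, P g → P (sigma2⁻¹ * g)) (g : BraidThree) :
    P g := by
  have hg : g ∈ Subgroup.closure (Set.range (PresentedGroup.of : Fin 2 → BraidThree)) := by
    rw [PresentedGroup.closure_range_of]; trivial
  induction hg using Subgroup.closure_induction_left with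
  | one => exact h1
  | mul_left x hx y _ ih =>
    obtain ⟨i, rfl⟩ := hx
    fin_cases i
    · exact ha _ ih
    · exact hb _ ih
  | inv_mul_cancel x hx y _ ih =>
    obtain ⟨i, rfl⟩ := hx
    fin_cases i
    · exact ha' _ ih
    · exact hb' _ ih

def btX : BraidThree := sigma1 * sigma2 * sigma1
def btY : BraidThree := sigma1 * sigma2
def btZ : BraidThree := btX * btX

theorem btX_a : btX * sigma1 = sigma2 * btX := by
  unfold btX
  conv_rhs => rw [← mul_assoc, ← mul_assoc, ← bt_rel]

theorem btX_b : btX * sigma2 = sigma1 * btX := by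
  unfold btX
  conv_rhs => rw [bt_rel, ← mul_assoc, ← mul_assoc]

theorem btZ_a : btZ * sigma1 = sigma1 * btZ := by
  rw [btZ, mul_assoc, btX_a, ← mul_assoc, btX_b, mul_assoc]

theorem btZ_b : btZ * sigma2 = sigma2 * btZ := by
  rw [btZ, mul_assoc, btX_b, ← mul_assoc, btX_a, mul_assoc]

theorem btZ_comm (g : BraidThree) : Commute btZ g := by
  induction g using bt_induction with
  | h1 => exact Commute.one_right _
  | ha g ih => exact Commute.mul_right btZ_a ih
  | hb g ih => exact Commute.mul_right btZ_b ih
  | ha' g ih => exact Commute.mul_right (Commute.inv_right btZ_a) ih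
  | hb' g ih => exact Commute.mul_right (Commute.inv_right btZ_b) ih

theorem btY3 : btY * btY * btY = btZ := by
  have : btY * btY * btY = btX * (sigma2 * sigma1 * sigma2) := by
    simp only [btY, btX, mul_assoc]
  rw [this, ← bt_rel]; rfl

theorem btX_eq : btX = btY * sigma1 := rfl

theorem bt_a : sigma1 = btY⁻¹ * btX := by rw [btX_eq]; group

theorem bt_b : sigma2 = btX⁻¹ * (btY * btY) := by
  have h : btY = sigma1 * sigma2 := rfl
  rw [eq_inv_mul_iff_mul_eq, btX_eq]
  conv_rhs => rw [h]
  conv_lhs => rw [h]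
  group

/-- The submonoid of words in `σ₁⁻¹` and `σ₂`. -/
inductive BtMono : BraidThree → Prop
  | one : BtMono 1
  | a (w) : BtMono w → BtMono (sigma1⁻¹ * w)
  | b (w) : BtMono w → BtMono (sigma2 * w)

def BtNF (g : BraidThree) : Prop :=
  ∃ (k : ℤ) (u v w : BraidThree), (u = 1 ∨ u = btY ∨ u = btY * btY) ∧ (v = 1 ∨ v = btX) ∧
    BtMono w ∧ g = btZ ^ k * (u * w * v)

theorem btNF_Z (n : ℤ) {g} (h : BtNF g) : BtNF (btZ ^ n * g) := by
  obtain ⟨k, u, v, w, hu, hv, hw, rfl⟩ := h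
  exact ⟨n + k, u, v, w, hu, hv, hw, by simp only [zpow_add, mul_assoc]⟩

theorem btNF_core {u v w} (hu : u = 1 ∨ u = btY ∨ u = btY * btY) (hv : v = 1 ∨ v = btX)
    (hw : BtMono w) : BtNF (u * w * v) := ⟨0, u, v, w, hu, hv, hw, by simp⟩

theorem bt_pull (c g : BraidThree) (k : ℤ) : c * (btZ ^ k * g) = btZ ^ k * (c * g) := by
  rw [← mul_assoc, ← ((btZ_comm c).zpow_left k).eq, mul_assoc]

theorem btNF_Y {g} (h : BtNF g) : BtNF (btY * g) := by
  obtain ⟨k, u, v, w, hu, hv, hw, rfl⟩ := h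
  rw [bt_pull]
  apply btNF_Z
  rcases hu with rfl | rfl | rfl
  · have := btNF_core (u := btY) (by simp) hv hw
    simpa [mul_assoc] using this
  · have := btNF_core (u := btY * btY) (by simp) hv hw
    simpa [mul_assoc] using this
  · have := btNF_Z 1 (btNF_core (u := 1) (by simp) hv hw)
    rw [zpow_one, ← btY3] at this
    simpa [mul_assoc] using this

theorem btX_inv : btX⁻¹ = btZ ^ (-1 : ℤ) * btX := by
  rw [btZ]; group

theorem btY_inv : btY⁻¹ = btZ ^ (-1 : ℤ) * (btY * btY) := by
  rw [← btY3]; group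

theorem btX_via : btX = btZ * btX⁻¹ := by rw [btZ]; group

theorem btNF_X {g} (h : BtNF g) : BtNF (btX * g) := by
  obtain ⟨k, u, v, w, hu, hv, hw, rfl⟩ := h
  rw [bt_pull]
  apply btNF_Z
  rcases hu with rfl | rfl | rfl
  · cases hw with
    | one =>
      rcases hv with rfl | rfl
      · have := btNF_core (u := 1) (v := btX) (by simp) (by simp) BtMono.one
        simpa using this
      · have := btNF_Z 1 (btNF_core (u := 1) (v := 1) (by simp) (by simp) BtMono.one)
        simpa [btZ] using this
    | a w hw =>
      have := btNF_core (u := btY) (by simp) hv hw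
      rw [bt_a]
      simpa [mul_assoc] using this
    | b w hw =>
      have := btNF_core (u := btY * btY) (by simp) hv hw
      rw [bt_b]
      simpa [mul_assoc] using this
  · have := btNF_Z 1 (btNF_core (u := 1) (by simp) hv (BtMono.a w hw))
    rw [btX_via]
    rw [bt_a] at this
    simpa [mul_assoc] using this
  · have := btNF_Z 1 (btNF_core (u := 1) (by simp) hv (BtMono.b w hw))
    rw [btX_via]
    rw [bt_b] at this
    simpa [mul_assoc] using this

theorem btNF_X' {g} (h : BtNF g) : BtNF (btX⁻¹ * g) := by
  rw [btX_inv, mul_assoc]; exact btNF_Z _ (btNF_X h)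

theorem btNF_Y' {g} (h : BtNF g) : BtNF (btY⁻¹ * g) := by
  rw [btY_inv, mul_assoc, mul_assoc]; exact btNF_Z _ (btNF_Y (btNF_Y h))

theorem btNF_all (g : BraidThree) : BtNF g := by
  induction g using bt_induction with
  | h1 => simpa using btNF_core (u := 1) (v := 1) (by simp) (by simp) BtMono.one
  | ha g ih => rw [bt_a, mul_assoc]; exact btNF_Y' (btNF_X ih)
  | hb g ih => rw [bt_b, mul_assoc, mul_assoc]; exact btNF_X' (btNF_Y (btNF_Y ih))
  | ha' g ih =>
    rw [bt_a, mul_inv_rev, inv_inv, mul_assoc]; exact btNF_X' (btNF_Y ih)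
  | hb' g ih =>
    rw [bt_b, mul_inv_rev, inv_inv, mul_inv_rev, mul_assoc, mul_assoc]
    exact btNF_Y' (btNF_Y' (btNF_X ih))

def btA : SpecialLinearGroup (Fin 2) ℤ := ⟨!![1, 1; 0, 1], by norm_num [Matrix.det_fin_two_of]⟩
def btB : SpecialLinearGroup (Fin 2) ℤ := ⟨!![1, 0; -1, 1], by norm_num [Matrix.det_fin_two_of]⟩

def btPhi : BraidThree →* SpecialLinearGroup (Fin 2) ℤ :=
  PresentedGroup.toGroup (f := ![btA, btB]) (by
    intro r hr
    rw [braidRel, Set.mem_singleton_iff] at hr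
    subst hr
    simp only [map_mul, map_inv, FreeGroup.lift_apply_of]
    rw [mul_inv_eq_one]
    decide)

theorem btPhi_a : btPhi sigma1 = btA := PresentedGroup.toGroup.of _
theorem btPhi_b : btPhi sigma2 = btB := PresentedGroup.toGroup.of _

def btMX : SpecialLinearGroup (Fin 2) ℤ := ⟨!![0, 1; -1, 0], by norm_num [Matrix.det_fin_two_of]⟩
def btMY : SpecialLinearGroup (Fin 2) ℤ := ⟨!![0, 1; -1, 1], by norm_num [Matrix.det_fin_two_of]⟩
def btA' : SpecialLinearGroup (Fin 2) ℤ := ⟨!![1, -1; 0, 1], by norm_num [Matrix.det_fin_two_of]⟩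

def btM (g : BraidThree) : Matrix (Fin 2) (Fin 2) ℤ := ((btPhi g : SpecialLinearGroup (Fin 2) ℤ) : Matrix (Fin 2) (Fin 2) ℤ)

theorem btM_mul (g h : BraidThree) : btM (g * h) = btM g * btM h := by simp [btM]

theorem btPhi_X : btPhi btX = btMX := by
  simp only [btX, map_mul, btPhi_a, btPhi_b]; decide

theorem btPhi_Y : btPhi btY = btMY := by
  simp only [btY, map_mul, btPhi_a, btPhi_b]; decide

theorem btM_one : btM 1 = !![1, 0; 0, 1] := by simp [btM, Matrix.one_fin_two]
theorem btM_a : btM sigma1 = !![1, 1; 0, 1] := by rw [btM, btPhi_a]; rfl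
theorem btM_a' : btM sigma1⁻¹ = !![1, -1; 0, 1] := by
  have : btA⁻¹ = btA' := by decide
  rw [btM, map_inv, btPhi_a, this]; rfl
theorem btM_b : btM sigma2 = !![1, 0; -1, 1] := by rw [btM, btPhi_b]; rfl
theorem btM_X : btM btX = !![0, 1; -1, 0] := by rw [btM, btPhi_X]; rfl
theorem btM_Y : btM btY = !![0, 1; -1, 1] := by rw [btM, btPhi_Y]; rfl

theorem btPhi_Z : btPhi btZ = -1 := by
  simp only [btZ, map_mul, btPhi_X]; decide

theorem bt_sl_neg_one_zpow (k : ℤ) : (-1 : SpecialLinearGroup (Fin 2) ℤ) ^ k = 1 ∨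
    (-1 : SpecialLinearGroup (Fin 2) ℤ) ^ k = -1 := by
  have h2 : (-1 : SpecialLinearGroup (Fin 2) ℤ) ^ (2 : ℤ) = 1 := by decide
  rcases Int.even_or_odd' k with ⟨m, rfl | rfl⟩
  · left; rw [zpow_mul, h2, one_zpow]
  · right; rw [zpow_add, zpow_mul, h2, one_zpow, one_mul, zpow_one]

theorem btMono_pattern {w} (hw : BtMono w) :
    ∃ p q r s : ℤ, btM w = !![p, -q; -r, s] ∧ 1 ≤ p ∧ 0 ≤ q ∧ 0 ≤ r ∧ 1 ≤ s ∧
      (w = 1 ∨ 1 ≤ q + r) := by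
  induction hw with
  | one => exact ⟨1, 0, 0, 1, by simp [btM_one], by simp⟩
  | a w _ ih =>
    obtain ⟨p, q, r, s, h, hp, hq, hr, hs, _⟩ := ih
    refine ⟨p + r, q + s, r, s, ?_, by lia, by lia, by lia, by lia, by right; lia⟩
    rw [btM_mul, btM_a', h]
    ext i j; fin_cases i <;> fin_cases j <;> simp [Matrix.mul_apply, Fin.sum_univ_two] <;> ring
  | b w _ ih =>
    obtain ⟨p, q, r, s, h, hp, hq, hr, hs, _⟩ := ih
    refine ⟨p, q, p + r, q + s, ?_, by lia, by lia, by lia, by lia, by right; lia⟩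
    rw [btM_mul, btM_b, h]
    ext i j; fin_cases i <;> fin_cases j <;> simp [Matrix.mul_apply, Fin.sum_univ_two] <;> ring

theorem bt_core {g} (h : btPhi g = 1 ∨ btPhi g = -1) : ∃ k : ℤ, g = btZ ^ k := by
  obtain ⟨k, u, v, w, hu, hv, hw, rfl⟩ := btNF_all g
  have h' : btPhi (u * w * v) = 1 ∨ btPhi (u * w * v) = -1 := by
    rw [map_mul, map_zpow, btPhi_Z] at h
    rcases bt_sl_neg_one_zpow k with e | e <;> rw [e] at h
    · simpa using h
    · rcases h with h | h
      · right; rw [← h]; simp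
      · left; simpa using h
  obtain ⟨p, q, r, s, e, hp, hq, hr, hs, hw1⟩ := btMono_pattern hw
  have key : u = 1 ∧ v = 1 ∧ w = 1 := by
    rcases hw1 with hw1 | hw1
    all_goals
      have h00 : btM (u * w * v) 0 0 = 1 ∧ btM (u * w * v) 0 1 = 0 ∧
        btM (u * w * v) 1 0 = 0 ∧ btM (u * w * v) 1 1 = 1 ∨
        btM (u * w * v) 0 0 = -1 ∧ btM (u * w * v) 0 1 = 0 ∧
        btM (u * w * v) 1 0 = 0 ∧ btM (u * w * v) 1 1 = -1 := by
        rcases h' with h' | h' <;> simp [btM, h', -map_mul]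
      clear h h'
      rcases hu with rfl | rfl | rfl <;> rcases hv with rfl | rfl <;>
      simp [btM_mul, btM_one, btM_X, btM_Y, e, Matrix.mul_apply, Fin.sum_univ_two] at h00 <;>
      first
        | exact ⟨rfl, rfl, hw1⟩
        | (exfalso; omega)
  obtain ⟨rfl, rfl, rfl⟩ := key
  exact ⟨k, by simp⟩

theorem btY_pow3 : (sigma1 * sigma2) ^ 3 = btZ := by
  rw [← btY3, pow_succ, pow_two]; rfl

theorem btY_pow6 : (sigma1 * sigma2) ^ 6 = btZ ^ 2 := by
  rw [← btY_pow3, ← pow_mul]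

def btLen : BraidThree →* Multiplicative ℤ :=
  PresentedGroup.toGroup (f := fun _ => Multiplicative.ofAdd 1) (by
    intro r hr
    rw [braidRel, Set.mem_singleton_iff] at hr
    subst hr
    simp)

theorem btLen_Z : btLen btZ = Multiplicative.ofAdd 6 := by
  have h1 : btLen sigma1 = Multiplicative.ofAdd 1 := PresentedGroup.toGroup.of _
  have h2 : btLen sigma2 = Multiplicative.ofAdd 1 := PresentedGroup.toGroup.of _
  simp only [btZ, btX, map_mul, h1, h2]; rfl

/-- There is a surjective homomorphism `B₃ → SL(2,ℤ)`, sending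
`σ₁ ↦ [[1,1],[0,1]]`, `σ₂ ↦ [[1,0],[-1,1]]`, whose kernel is infinite cyclic,
generated by `(σ₁σ₂)⁶ = ((σ₁σ₂σ₁)²)²`, the square of the generator
`(σ₁σ₂σ₁)² = (σ₁σ₂)³` of the (infinite cyclic) center of `B₃`. -/
theorem stmt15 :
    ∃ φ : BraidThree →* Matrix.SpecialLinearGroup (Fin 2) ℤ,
      Function.Surjective φ ∧
      φ sigma1 = ⟨!![1, 1; 0, 1], by norm_num [Matrix.det_fin_two_of]⟩ ∧
      φ sigma2 = ⟨!![1, 0; -1, 1], by norm_num [Matrix.det_fin_two_of]⟩ ∧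
      φ.ker = Subgroup.zpowers ((sigma1 * sigma2) ^ 6) ∧
      (sigma1 * sigma2) ^ 6 = ((sigma1 * sigma2 * sigma1) ^ 2) ^ 2 ∧
      Subgroup.center BraidThree = Subgroup.zpowers ((sigma1 * sigma2) ^ 3) ∧
      ¬ IsOfFinOrder ((sigma1 * sigma2) ^ 6) := by
  refine ⟨btPhi, ?_, btPhi_a, btPhi_b, ?_, ?_, ?_, ?_⟩
  · rw [← MonoidHom.range_eq_top, eq_top_iff, ← SpecialLinearGroup.SL2Z_generators,
      Subgroup.closure_le]
    intro g hg
    rcases hg with rfl | rfl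
    · exact ⟨btX⁻¹, by rw [map_inv, btPhi_X]; decide⟩
    · exact ⟨sigma1, by rw [btPhi_a]; decide⟩
  · rw [btY_pow6]
    ext g
    rw [MonoidHom.mem_ker, Subgroup.mem_zpowers_iff]
    constructor
    · intro h
      obtain ⟨k, rfl⟩ := bt_core (Or.inl h)
      rw [map_zpow, btPhi_Z] at h
      rcases Int.even_or_odd' k with ⟨m, rfl | rfl⟩
      · exact ⟨m, by rw [zpow_mul]; rfl⟩
      · exfalso
        have h2 : (-1 : SpecialLinearGroup (Fin 2) ℤ) ^ (2 : ℤ) = 1 := by decide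
        rw [zpow_add, zpow_mul, h2, one_zpow, one_mul, zpow_one] at h
        revert h; decide
    · rintro ⟨m, rfl⟩
      rw [map_zpow, map_pow, btPhi_Z]
      simp
  · rw [btY_pow6, pow_two btZ, pow_two (_ * _ * _), pow_two]; rfl
  · rw [btY_pow3]
    ext g
    rw [Subgroup.mem_center_iff, Subgroup.mem_zpowers_iff]
    constructor
    · intro h
      have ha := congrArg btM (h sigma1)
      have hb := congrArg btM (h sigma2)
      have hd : (btM g).det = 1 := (btPhi g).2
      have : btPhi g = 1 ∨ btPhi g = -1 := by
        rw [btM_mul, btM_mul, btM_a] at ha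
        rw [btM_mul, btM_mul, btM_b] at hb
        have a00 := congrFun (congrFun ha 0) 0
        have a01 := congrFun (congrFun ha 0) 1
        have b00 := congrFun (congrFun hb 0) 0
        simp [Matrix.mul_apply, Fin.sum_univ_two] at a00 a01 b00
        rw [Matrix.det_fin_two] at hd
        have e : btM g 1 1 = btM g 0 0 := by omega
        have e1 : btM g 0 1 = 0 := by omega
        have e2 : btM g 1 0 = 0 := by omega
        rw [e, e1, e2] at hd
        have hs : btM g 0 0 * btM g 0 0 = 1 := by linarith
        rcases mul_self_eq_one_iff.mp hs with h0 | h0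
        · left; ext i j; change btM g i j = _
          fin_cases i <;> fin_cases j <;> simp [e, e1, e2, h0]
        · right; ext i j; change btM g i j = _
          fin_cases i <;> fin_cases j <;> simp [e, e1, e2, h0]
      obtain ⟨k, hk⟩ := bt_core this
      exact ⟨k, hk.symm⟩
    · rintro ⟨k, rfl⟩ c
      exact (((btZ_comm c).zpow_left k).eq).symm
  · rw [btY_pow6, isOfFinOrder_iff_pow_eq_one]
    rintro ⟨n, hn, h⟩
    have := congrArg (fun m => (btLen m).toAdd) h
    simp [btLen_Z] at this
    lia
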